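/- arXiv:1908.03323 — 2 statements merged into one kernel-verified Lean document; each statement's English description precedes it below -/
import Mathlib

section
/- Let S be a bounded subset of ℝⁿ whose convex hull has nonempty interior, and let K = closure(convexHull S). (i) For every convex set D with S ⊆ D, the Lebesgue measure of K is at most the Lebesgue measure of D. (ii) If C is a closed convex set with S ⊆ C and the Lebesgue measure of C equals the Lebesgue measure of K, then C = K. -/
open MeasureTheory

/-- Two nested closed convex sets of equal finite measure, the larger of which has nonempty
interior, coincide. -/
theorem Convex.eq_of_subset_of_measure_le {E : Type*} [NormedAddCommGroup E] [NormedSpace ℝ E]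
    [MeasurableSpace E] [BorelSpace E] (μ : Measure E) [μ.IsOpenPosMeasure] {C K : Set E}
    (hC : Convex ℝ C) (hCint : (interior C).Nonempty) (hK : IsClosed K) (hKC : K ⊆ C)
    (hfin : μ K ≠ ⊤) (hle : μ C ≤ μ K) : C = K := by
  have hnull : μ (C \ K) = 0 := by
    rw [measure_sdiff hKC hK.measurableSet.nullMeasurableSet hfin, tsub_eq_zero_of_le hle]
  have hempty : interior C \ K = ∅ :=
    (isOpen_interior.sdiff hK).eq_empty_of_measure_zero
      (measure_mono_null (Set.sdiff_subset_sdiff_left interior_subset) hnull)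
  refine Set.Subset.antisymm ?_ hKC
  calc C ⊆ closure C := subset_closure
    _ = closure (interior C) :=
      (hC.closure_interior_eq_closure_of_nonempty_interior hCint).symm
    _ ⊆ K := closure_minimal (Set.sdiff_eq_empty.mp hempty) hK

/-- The closed convex hull `K` of a bounded set `S ⊆ ℝⁿ` whose convex hull has nonempty
interior is the unique minimizer of Lebesgue measure among (closed) convex sets containing
`S`: (i) `volume K ≤ volume D` for every convex `D ⊇ S`, and (ii) any closed convex `C ⊇ S`
with `volume C = volume K` equals `K`. -/
theorem convexHull_volume_min_unique (n : ℕ) (S : Set (EuclideanSpace ℝ (Fin n)))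
    (hSbd : Bornology.IsBounded S)
    (hint : (interior (convexHull ℝ S)).Nonempty)
    (K : Set (EuclideanSpace ℝ (Fin n))) (hK : K = closure (convexHull ℝ S)) :
    (∀ D : Set (EuclideanSpace ℝ (Fin n)), Convex ℝ D → S ⊆ D → volume K ≤ volume D) ∧
    (∀ C : Set (EuclideanSpace ℝ (Fin n)), IsClosed C → Convex ℝ C → S ⊆ C →
      volume C = volume K → C = K) := by
  subst hK
  refine ⟨fun D hD hSD => ?_, fun C hCcl hC hSC hvol => ?_⟩
  · rw [measure_closure_of_null_frontier ((convex_convexHull ℝ S).addHaar_frontier volume)]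
    exact measure_mono (convexHull_min hSD hD)
  · have hsub : convexHull ℝ S ⊆ C := convexHull_min hSC hC
    exact hC.eq_of_subset_of_measure_le volume (hint.mono (interior_mono hsub))
      isClosed_closure (closure_minimal hsub hCcl)
      (isBounded_convexHull.mpr hSbd).closure.measure_lt_top.ne hvol.le
end

section
/- Let A ⊆ B be compact convex subsets of ℝ², each with nonempty interior. Then the one-dimensional Hausdorff measure of the frontier of A is at most the one-dimensional Hausdorff measure of the frontier of B. -/
open MeasureTheory

section InnerProductSpace

variable {E : Type*} [NormedAddCommGroup E] [InnerProductSpace ℝ E]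

/-- If `a` and `a'` are the points of `A` obtained by metric projection of `b` and `b'`
(expressed through the variational inequality), then they are at most as far apart as
`b` and `b'`. -/
theorem dist_le_dist_of_inner_nonpos {a a' b b' : E}
    (h : inner ℝ (b - a) (a' - a) ≤ 0) (h' : inner ℝ (b' - a') (a - a') ≤ 0) :
    dist a a' ≤ dist b b' := by
  have key : ‖a - a'‖ * ‖a - a'‖ ≤ ‖b - b'‖ * ‖a - a'‖ := by
    rw [← real_inner_self_eq_norm_mul_norm]
    refine le_trans ?_ (real_inner_le_norm _ _)
    simp only [inner_sub_left, inner_sub_right] at h h' ⊢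
    linarith
  rw [dist_eq_norm, dist_eq_norm]
  rcases (norm_nonneg (a - a')).eq_or_lt with h0 | h0
  · rw [← h0]
    exact norm_nonneg _
  · exact le_of_mul_le_mul_right key h0

/-- A frontier point of a convex body has a nonzero outer normal vector. -/
theorem Convex.exists_ne_zero_inner_nonpos_of_mem_frontier [CompleteSpace E] {A : Set E}
    (hA : Convex ℝ A) (hint : (interior A).Nonempty) {a : E} (ha : a ∈ frontier A) :
    ∃ u : E, u ≠ 0 ∧ ∀ w ∈ A, inner ℝ u (w - a) ≤ 0 := by
  obtain ⟨f, hf⟩ := geometric_hahn_banach_open_point hA.interior isOpen_interior ha.2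
  refine ⟨(InnerProductSpace.toDual ℝ E).symm f, ?_, fun w hw ↦ ?_⟩
  · rintro h0
    obtain ⟨x, hx⟩ := hint
    have hf0 : f = 0 := by simpa using h0
    simpa [hf0] using hf x hx
  · have hw' : w ∈ closure (interior A) := by
      rw [hA.closure_interior_eq_closure_of_nonempty_interior hint]
      exact subset_closure hw
    have : closure (interior A) ⊆ {x | f x ≤ f a} :=
      closure_minimal (fun x hx ↦ (hf x hx).le) (isClosed_le f.continuous continuous_const)
    simpa [InnerProductSpace.toDual_symm_apply] using this hw'

/-- A ray issued from a point of a bounded set meets the frontier of that set. -/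
theorem Bornology.IsBounded.exists_add_smul_mem_frontier {B : Set E} (hB : Bornology.IsBounded B)
    {a u : E} (ha : a ∈ B) (hu : u ≠ 0) : ∃ t : ℝ, 0 ≤ t ∧ a + t • u ∈ frontier B := by
  obtain ⟨R, hR⟩ := hB.subset_closedBall a
  have hu' : 0 < ‖u‖ := norm_pos_iff.2 hu
  let f : NNReal → E := fun t ↦ a + (t : ℝ) • u
  have hf : Continuous f := by fun_prop
  have hT : f (NNReal.mk ((|R| + 1) / ‖u‖) (by positivity)) ∉ B := fun h ↦ by
    have := hR h
    rw [mem_closedBall_iff_norm, add_sub_cancel_left, norm_smul, NNReal.coe_mk,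
      Real.norm_of_nonneg (by positivity), div_mul_cancel₀ _ hu'.ne'] at this
    linarith [le_abs_self R]
  obtain ⟨t, ht⟩ : (frontier (f ⁻¹' B)).Nonempty :=
    nonempty_frontier_iff.2 ⟨⟨0, by simpa [f] using ha⟩, fun h ↦ hT (h ▸ Set.mem_univ _ :)⟩
  exact ⟨t, t.2, hf.frontier_preimage_subset B ht⟩

/-- Monotonicity of the Hausdorff measure of the frontier for nested convex sets, in any
dimension. -/
theorem Convex.hausdorffMeasure_frontier_mono [CompleteSpace E] [MeasurableSpace E] [BorelSpace E]
    {A B : Set E} (hA : Convex ℝ A) (hAclosed : IsClosed A) (hint : (interior A).Nonempty)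
    (hB : Bornology.IsBounded B) (hAB : A ⊆ B) {d : ℝ} (hd : 0 ≤ d) :
    μH[d] (frontier A) ≤ μH[d] (frontier B) := by
  have hex : ∀ a : frontier A, ∃ b ∈ frontier B, ∀ w ∈ A, inner ℝ (b - a) (w - a) ≤ 0 := by
    rintro ⟨a, ha⟩
    obtain ⟨u, hu, hmax⟩ := hA.exists_ne_zero_inner_nonpos_of_mem_frontier hint ha
    obtain ⟨t, ht, hb⟩ := hB.exists_add_smul_mem_frontier (hAB (hAclosed.frontier_subset ha)) hu
    refine ⟨_, hb, fun w hw ↦ ?_⟩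
    rw [add_sub_cancel_left, real_inner_smul_left]
    exact mul_nonpos_of_nonneg_of_nonpos ht (hmax w hw)
  choose g hg hproj using hex
  have hanti : AntilipschitzWith 1 g := AntilipschitzWith.of_le_mul_dist fun a a' ↦ by
    simpa [Subtype.dist_eq] using dist_le_dist_of_inner_nonpos
      (hproj a a' (hAclosed.frontier_subset a'.2))
      (hproj a' a (hAclosed.frontier_subset a.2))
  calc μH[d] (frontier A) = μH[d] (Set.univ : Set (frontier A)) := by
        rw [← (isometry_subtype_coe (s := frontier A)).hausdorffMeasure_image (Or.inl hd),
          Set.image_univ, Subtype.range_coe]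
    _ ≤ μH[d] (g '' Set.univ) := by simpa using hanti.le_hausdorffMeasure_image hd Set.univ
    _ ≤ μH[d] (frontier B) := measure_mono (by rintro _ ⟨a, -, rfl⟩; exact hg a)

end InnerProductSpace

/-- Monotonicity of boundary length for nested compact convex planar sets: if `A ⊆ B` are
compact convex subsets of `ℝ²` with nonempty interiors, then the one-dimensional Hausdorff
measure of `frontier A` is at most that of `frontier B`. -/
theorem frontier_length_mono (A B : Set (EuclideanSpace ℝ (Fin 2)))
    (hAB : A ⊆ B)
    (hAcpt : IsCompact A) (hAconv : Convex ℝ A) (hAint : (interior A).Nonempty)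
    (hBcpt : IsCompact B) (hBconv : Convex ℝ B) (hBint : (interior B).Nonempty) :
    μH[1] (frontier A) ≤ μH[1] (frontier B) := by
  exact hAconv.hausdorffMeasure_frontier_mono hAcpt.isClosed hAint hBcpt.isBounded hAB zero_le_one
end
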